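/- arXiv:2112.12789 — 3 statements merged into one kernel-verified Lean document; each statement's English description precedes it below -/
import Mathlib

section
/- Let A and B be unital C*-algebras and Φ : A →L[ℂ] B a continuous linear star-preserving map, i.e. Φ(star a) = star(Φ(a)) for all a ∈ A. Let Φ₂ denote the entrywise application of Φ to 2×2 matrices (with 2×2 matrices over A and B carrying their canonical C*-norms). Then ‖Φ‖ ≤ sSup { ‖Φ₂(M)‖ : M a self-adjoint 2×2 matrix over A with ‖M‖ ≤ 1 }. -/
open CStarMatrix in
/-- Any C*-norm on the `2 × 2` matrices coincides with the `CStarMatrix` norm. -/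
lemma norm_equiv_eq_cstar {A MA : Type*} [CStarAlgebra A] [PartialOrder A] [StarOrderedRing A] [CStarAlgebra MA]
    (eA : Matrix (Fin 2) (Fin 2) A ≃⋆ₐ[ℂ] MA) (M : Matrix (Fin 2) (Fin 2) A) :
    ‖eA M‖ = ‖ofMatrix M‖ := by
  let e : CStarMatrix (Fin 2) (Fin 2) A ≃⋆ₐ[ℂ] MA :=
    (CStarMatrix.ofMatrixStarAlgEquiv (n := Fin 2) (A := A)).symm.trans eA
  exact NonUnitalStarAlgHom.norm_map e e.injective (ofMatrix M)

/-- The diagonal embedding. -/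
def diagStarHom (A : Type*) [CStarAlgebra A] :
    (A × A) →⋆ₙₐ[ℂ] CStarMatrix (Fin 2) (Fin 2) A where
  toFun p := CStarMatrix.ofMatrix !![p.1, 0; 0, p.2]
  map_smul' c p := by
    ext i j; fin_cases i <;> fin_cases j <;> simp
  map_zero' := by
    ext i j; fin_cases i <;> fin_cases j <;> simp
  map_add' p q := by
    ext i j; fin_cases i <;> fin_cases j <;> simp
  map_mul' p q := by
    ext i j; fin_cases i <;> fin_cases j <;> simp [CStarMatrix.mul_apply]
  map_star' p := by
    ext i j; fin_cases i <;> fin_cases j <;> simp [CStarMatrix.star_apply]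

lemma norm_diag_eq {A : Type*} [CStarAlgebra A] [PartialOrder A] [StarOrderedRing A] (x y : A) :
    ‖CStarMatrix.ofMatrix !![x, 0; 0, y]‖ = max ‖x‖ ‖y‖ := by
  have hinj : Function.Injective (diagStarHom A) := by
    intro p q h
    have h0 := congrArg (fun M => M 0 0) h
    have h1 := congrArg (fun M => M 1 1) h
    exact Prod.ext h0 h1
  exact NonUnitalStarAlgHom.norm_map (diagStarHom A) hinj (x, y)

/-- Self-adjoint dilation. -/
def dilation {A : Type*} [CStarAlgebra A] (a : A) : CStarMatrix (Fin 2) (Fin 2) A :=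
  CStarMatrix.ofMatrix !![0, a; star a, 0]

lemma dilation_star {A : Type*} [CStarAlgebra A] (a : A) : star (dilation a) = dilation a := by
  ext i j; fin_cases i <;> fin_cases j <;> simp [dilation, CStarMatrix.star_apply]

lemma norm_dilation {A : Type*} [CStarAlgebra A] [PartialOrder A] [StarOrderedRing A] (a : A) : ‖dilation a‖ = ‖a‖ := by
  have h : star (dilation a) * dilation a
      = CStarMatrix.ofMatrix !![a * star a, 0; 0, star a * a] := by
    rw [dilation_star]
    ext i j; fin_cases i <;> fin_cases j <;> simp [dilation, CStarMatrix.mul_apply]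
  have h2 := CStarRing.norm_star_mul_self (x := dilation a)
  rw [h, norm_diag_eq, CStarRing.norm_self_mul_star, CStarRing.norm_star_mul_self, max_self] at h2
  exact (mul_self_inj (norm_nonneg _) (norm_nonneg _)).1 h2.symm

/-- Entrywise application is bounded. -/
lemma exists_bound_entrywise {A B : Type*} [CStarAlgebra A] [PartialOrder A] [StarOrderedRing A] [CStarAlgebra B]
    [PartialOrder B] [StarOrderedRing B] (Φ : A →L[ℂ] B) :
    ∃ C : ℝ, ∀ M : CStarMatrix (Fin 2) (Fin 2) A, ‖M.map Φ‖ ≤ C * ‖M‖ := by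
  let L : CStarMatrix (Fin 2) (Fin 2) A →ₗ[ℂ] CStarMatrix (Fin 2) (Fin 2) B :=
    CStarMatrix.mapₗ Φ.toLinearMap
  have hc : Continuous L := by
    have h : Continuous (fun M : Matrix (Fin 2) (Fin 2) A => M.map Φ) :=
      continuous_id.matrix_map Φ.continuous
    exact h
  let T : CStarMatrix (Fin 2) (Fin 2) A →L[ℂ] CStarMatrix (Fin 2) (Fin 2) B := ⟨L, hc⟩
  exact ⟨‖T‖, fun M => T.le_opNorm M⟩

/-- Let `A`, `B` be unital C*-algebras and `Φ : A →L[ℂ] B` a continuous linear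
star-preserving map.  Then `‖Φ‖` is at most the supremum of `‖Φ₂ M‖` over self-adjoint 2×2
matrices `M` over `A` of norm at most 1, where `Φ₂` is the entrywise application of `Φ` and the
2×2 matrices over `A` and over `B` carry their canonical C*-norms.

Since `CStarMatrix` is not available in this version of Mathlib, we model "the C*-algebra of
2×2 matrices over `A` (resp. `B`) with its canonical C*-norm" as an arbitrary C*-algebra `MA`
(resp. `MB`) equipped with a ℂ-star-algebra isomorphism from the *-algebra of 2×2 matrices;
this is faithful because a *-algebra carries at most one complete C*-norm.  The entrywise
application `Φ₂` is `Matrix.map · Φ`, transported along these isomorphisms. -/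
theorem norm_le_sSup_selfAdjoint_norm_entrywise_map
    {A B : Type*} [CStarAlgebra A] [CStarAlgebra B]
    {MA MB : Type*} [CStarAlgebra MA] [CStarAlgebra MB]
    (eA : Matrix (Fin 2) (Fin 2) A ≃⋆ₐ[ℂ] MA)
    (eB : Matrix (Fin 2) (Fin 2) B ≃⋆ₐ[ℂ] MB)
    (Φ : A →L[ℂ] B) (hΦ : ∀ a : A, Φ (star a) = star (Φ a)) :
    ‖Φ‖ ≤ sSup {r : ℝ | ∃ m : MA, IsSelfAdjoint m ∧ ‖m‖ ≤ 1 ∧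
      r = ‖eB ((eA.symm m).map Φ)‖} := by
  letI : PartialOrder A := CStarAlgebra.spectralOrder A
  haveI : StarOrderedRing A := CStarAlgebra.spectralOrderedRing A
  letI : PartialOrder B := CStarAlgebra.spectralOrder B
  haveI : StarOrderedRing B := CStarAlgebra.spectralOrderedRing B
  obtain ⟨C, hC⟩ := exists_bound_entrywise Φ
  have hbdd : BddAbove {r : ℝ | ∃ m : MA, IsSelfAdjoint m ∧ ‖m‖ ≤ 1 ∧
      r = ‖eB ((eA.symm m).map Φ)‖} := by
    refine ⟨|C|, ?_⟩
    rintro r ⟨m, -, hm, rfl⟩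
    have h1 : ‖m‖ = ‖CStarMatrix.ofMatrix (eA.symm m)‖ := by
      rw [← norm_equiv_eq_cstar eA, StarAlgEquiv.apply_symm_apply]
    rw [norm_equiv_eq_cstar eB]
    calc _ ≤ C * ‖CStarMatrix.ofMatrix (eA.symm m)‖ := hC (CStarMatrix.ofMatrix (eA.symm m))
      _ ≤ |C| * 1 := by
        rw [← h1]
        exact mul_le_mul (le_abs_self C) hm (norm_nonneg _) (abs_nonneg _)
      _ = |C| := mul_one _
  have hnn : 0 ≤ sSup {r : ℝ | ∃ m : MA, IsSelfAdjoint m ∧ ‖m‖ ≤ 1 ∧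
      r = ‖eB ((eA.symm m).map Φ)‖} := by
    apply Real.sSup_nonneg
    rintro r ⟨m, -, -, rfl⟩
    exact norm_nonneg _
  refine ContinuousLinearMap.opNorm_le_of_unit_norm hnn ?_
  intro a ha
  refine le_csSup hbdd ⟨eA (CStarMatrix.ofMatrix.symm (dilation a)), ?_, ?_, ?_⟩
  · have h := congrArg (fun M => eA (CStarMatrix.ofMatrix.symm M)) (dilation_star a)
    exact (map_star eA (CStarMatrix.ofMatrix.symm (dilation a))).symm.trans h
  · rw [norm_equiv_eq_cstar eA, Equiv.apply_symm_apply, norm_dilation]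
    exact ha.le
  · rw [StarAlgEquiv.symm_apply_apply, norm_equiv_eq_cstar eB, ← norm_dilation (Φ a)]
    congr 1
    ext i j; fin_cases i <;> fin_cases j <;> simp [dilation, hΦ]
end

section
/- Let A and B be unital C*-algebras and Φ : A →L[ℂ] B a continuous linear star-preserving map, i.e. Φ(star a) = star(Φ(a)) for all a ∈ A. For each n ∈ ℕ, let Φₙ denote the entrywise application of Φ to n×n matrices, with n×n matrices over A and over B carrying their canonical C*-norms. Then, as suprema in [0,∞], ⨆ₙ ⨆ { ‖Φₙ(M)‖ : ‖M‖ ≤ 1 } = ⨆ₙ ⨆ { ‖Φₙ(M)‖ : M self-adjoint, ‖M‖ ≤ 1 }. In other words, the completely bounded norm of Φ equals the supremum over n of the norms of Φₙ restricted to self-adjoint elements. -/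
open scoped ENNReal

/-- The block diagonal embedding `(a, b) ↦ diag (a, b)`, as a star homomorphism. -/
noncomputable def blockDiagHom {A M N : Type*} [CStarAlgebra A] [CStarAlgebra M] [CStarAlgebra N]
    {n : ℕ} (e : Matrix (Fin n) (Fin n) A ≃⋆ₐ[ℂ] M)
    (f : Matrix (Fin (n + n)) (Fin (n + n)) A ≃⋆ₐ[ℂ] N) : M × M →⋆ₙₐ[ℂ] N where
  toFun p := f ((Matrix.fromBlocks (e.symm p.1) 0 0 (e.symm p.2)).submatrix
    finSumFinEquiv.symm finSumFinEquiv.symm)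
  map_smul' c p := by
    rw [MonoidHom.id_apply, ← map_smul, Prod.smul_fst, Prod.smul_snd, map_smul, map_smul]
    congr 1
    change _ = (c • Matrix.fromBlocks (e.symm p.1) 0 0 (e.symm p.2)).submatrix _ _
    rw [Matrix.fromBlocks_smul, smul_zero]
  map_zero' := by simp
  map_add' p q := by
    rw [← map_add, Prod.fst_add, Prod.snd_add, map_add, map_add]
    congr 1
    change _ = (Matrix.fromBlocks (e.symm p.1) 0 0 (e.symm p.2) +
      Matrix.fromBlocks (e.symm q.1) 0 0 (e.symm q.2)).submatrix _ _
    rw [Matrix.fromBlocks_add, add_zero]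
  map_mul' p q := by
    rw [← map_mul, Prod.fst_mul, Prod.snd_mul, map_mul, map_mul, Matrix.submatrix_mul_equiv,
      Matrix.fromBlocks_multiply]
    simp
  map_star' p := by
    rw [← map_star, Matrix.star_eq_conjTranspose, Matrix.conjTranspose_submatrix,
      Matrix.fromBlocks_conjTranspose, Prod.fst_star, Prod.snd_star, map_star, map_star]
    simp [Matrix.star_eq_conjTranspose]

theorem blockDiagHom_injective {A M N : Type*} [CStarAlgebra A] [CStarAlgebra M] [CStarAlgebra N]
    {n : ℕ} (e : Matrix (Fin n) (Fin n) A ≃⋆ₐ[ℂ] M)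
    (f : Matrix (Fin (n + n)) (Fin (n + n)) A ≃⋆ₐ[ℂ] N) :
    Function.Injective (blockDiagHom e f) := by
  rintro ⟨a, b⟩ ⟨c, d⟩ h
  have h1 := f.injective h
  have h2 := (Matrix.reindex finSumFinEquiv finSumFinEquiv).injective h1
  replace h2 := Matrix.fromBlocks_inj.1 h2
  exact Prod.ext (e.symm.injective h2.1) (e.symm.injective h2.2.2.2)

/-- The off-diagonal self-adjoint dilation of a matrix. -/
def offDiag {A : Type*} [CStarAlgebra A] {n : ℕ} (x : Matrix (Fin n) (Fin n) A) :
    Matrix (Fin (n + n)) (Fin (n + n)) A :=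
  (Matrix.fromBlocks 0 x (star x) 0).submatrix finSumFinEquiv.symm finSumFinEquiv.symm

theorem star_offDiag {A : Type*} [CStarAlgebra A] {n : ℕ} (x : Matrix (Fin n) (Fin n) A) :
    star (offDiag x) = offDiag x := by
  rw [offDiag, Matrix.star_eq_conjTranspose, Matrix.conjTranspose_submatrix,
      Matrix.fromBlocks_conjTranspose]
  simp [Matrix.star_eq_conjTranspose]

theorem norm_offDiag {A M N : Type*} [CStarAlgebra A] [CStarAlgebra M] [CStarAlgebra N]
    {n : ℕ} (e : Matrix (Fin n) (Fin n) A ≃⋆ₐ[ℂ] M)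
    (f : Matrix (Fin (n + n)) (Fin (n + n)) A ≃⋆ₐ[ℂ] N) (x : Matrix (Fin n) (Fin n) A) :
    ‖f (offDiag x)‖ = ‖e x‖ := by
  have h : star (f (offDiag x)) * f (offDiag x)
      = blockDiagHom e f (e x * star (e x), star (e x) * e x) := by
    change _ = f _
    rw [← map_star, star_offDiag, ← map_mul, offDiag, Matrix.submatrix_mul_equiv,
      Matrix.fromBlocks_multiply]
    simp [← map_star, ← map_mul]
  have h2 := congrArg norm h
  rw [CStarRing.norm_star_mul_self,
    NonUnitalStarAlgHom.norm_map (blockDiagHom e f) (blockDiagHom_injective e f), Prod.norm_def,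
    CStarRing.norm_star_mul_self, CStarRing.norm_self_mul_star, max_self] at h2
  exact (mul_self_inj (norm_nonneg _) (norm_nonneg _)).1 h2

/-- **Lemma 5.4 of the paper.** Let `A`, `B` be unital C*-algebras and
`Φ : A →L[ℂ] B` a continuous linear star-preserving map.  For each `n`, let `Φₙ` be the
entrywise application of `Φ` to n×n matrices (carrying their canonical C*-norms).  Then, as
suprema in `[0, ∞]`, the completely bounded norm of `Φ` equals the supremum over `n` of the
norms of `Φₙ` restricted to self-adjoint elements:
`⨆ₙ ⨆ {‖Φₙ M‖ : ‖M‖ ≤ 1} = ⨆ₙ ⨆ {‖Φₙ M‖ : M self-adjoint, ‖M‖ ≤ 1}`.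

Since `CStarMatrix` is not available in this version of Mathlib, we model "the C*-algebra of
n×n matrices over `A` (resp. `B`) with its canonical C*-norm" as an arbitrary C*-algebra
`MA n` (resp. `MB n`) equipped with a ℂ-star-algebra isomorphism from the *-algebra of
n×n matrices; this is faithful because a *-algebra carries at most one complete C*-norm.
The entrywise application `Φₙ` is `Matrix.map · Φ`, transported along these isomorphisms. -/
theorem cbNorm_eq_iSup_selfAdjoint
    {A B : Type*} [CStarAlgebra A] [CStarAlgebra B]
    (MA MB : ℕ → Type*) [∀ n, CStarAlgebra (MA n)] [∀ n, CStarAlgebra (MB n)]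
    (eA : ∀ n, Matrix (Fin n) (Fin n) A ≃⋆ₐ[ℂ] MA n)
    (eB : ∀ n, Matrix (Fin n) (Fin n) B ≃⋆ₐ[ℂ] MB n)
    (Φ : A →L[ℂ] B) (hΦ : ∀ a : A, Φ (star a) = star (Φ a)) :
    (⨆ (n : ℕ) (m : MA n) (_ : ‖m‖ ≤ 1),
        (‖eB n (((eA n).symm m).map Φ)‖₊ : ℝ≥0∞))
      = ⨆ (n : ℕ) (m : MA n) (_ : IsSelfAdjoint m) (_ : ‖m‖ ≤ 1),
          (‖eB n (((eA n).symm m).map Φ)‖₊ : ℝ≥0∞) := by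
  apply le_antisymm
  · refine iSup_le fun n => iSup_le fun m => iSup_le fun hm => ?_
    have key : ((eA (n + n)).symm (eA (n + n) (offDiag ((eA n).symm m)))).map Φ
        = offDiag (((eA n).symm m).map Φ) := by
      rw [StarAlgEquiv.symm_apply_apply, offDiag, offDiag, ← Matrix.submatrix_map,
        Matrix.fromBlocks_map]
      congr 2
      · ext i j; simp
      · ext i j; simp [Matrix.star_apply, hΦ]
      · ext i j; simp
    have hnorm : ‖eB n (((eA n).symm m).map Φ)‖₊
        = ‖eB (n + n) (((eA (n + n)).symm
            (eA (n + n) (offDiag ((eA n).symm m)))).map Φ)‖₊ := by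
      rw [key]
      exact NNReal.eq (norm_offDiag (eB n) (eB (n + n)) _).symm
    rw [hnorm]
    refine le_iSup_of_le (n + n) (le_iSup_of_le (eA (n + n) (offDiag ((eA n).symm m)))
      (le_iSup_of_le ?_ (le_iSup_of_le ?_ le_rfl)))
    · rw [IsSelfAdjoint, ← map_star, star_offDiag]
    · rw [norm_offDiag (eA n), StarAlgEquiv.apply_symm_apply]
      exact hm
  · refine iSup_mono fun n => iSup_mono fun m => iSup_le fun _ => le_rfl
end

section
/- Let A and B be unital C*-algebras and Φ : A →L[ℂ] B a continuous linear star-preserving map, i.e. Φ(star a) = star(Φ(a)) for all a ∈ A. For each n ∈ ℕ let Φₙ denote the entrywise application of Φ to n×n matrices, with n×n matrices over A and over B carrying their canonical C*-norms. Then, as suprema in [0,∞], the completely bounded norm of Φ satisfies ⨆ₙ ⨆ { ‖Φₙ(M)‖ : ‖M‖ ≤ 1 } = ⨆ₙ ⨆_{φ} ⨆ { |φ(Φₙ(M))| : ‖M‖ ≤ 1 }, where for each n the inner supremum is over all states φ on the C*-algebra of n×n matrices over B, i.e. all continuous linear functionals φ into ℂ with φ(1) = 1 and φ(star x * x) ≥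 0 (a nonnegative real) for all x. -/
open scoped ENNReal

namespace CbAux

open scoped ComplexOrder

/-- A positive unital functional is contractive. -/
lemma state_contractive {C : Type*} [CStarAlgebra C] (φ : C →L[ℂ] ℂ) (h1 : φ 1 = 1)
    (hpos : ∀ x : C, ∃ r : ℝ, 0 ≤ r ∧ φ (star x * x) = (r : ℂ)) (x : C) : ‖φ x‖ ≤ ‖x‖ := by
  let _ : PartialOrder C := CStarAlgebra.spectralOrder C
  have _ : StarOrderedRing C := CStarAlgebra.spectralOrderedRing C
  let f : C →ₚ[ℂ] ℂ := PositiveLinearMap.mk₀ (φ : C →ₗ[ℂ] ℂ) (by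
    intro a ha
    obtain ⟨y, rfl⟩ := CStarAlgebra.nonneg_iff_eq_star_mul_self.mp ha
    obtain ⟨r, hr, h⟩ := hpos y
    simp only [ContinuousLinearMap.coe_coe, h]
    exact_mod_cast hr)
  have hf : ∀ y, f y = φ y := fun y => rfl
  have h := norm_inner_le_norm (𝕜 := ℂ) (f.toPreGNS 1) (f.toPreGNS x)
  rw [PositiveLinearMap.preGNS_inner_def, PositiveLinearMap.preGNS_norm_def,
    PositiveLinearMap.preGNS_norm_def] at h
  simp only [PositiveLinearMap.ofPreGNS_toPreGNS, star_one, one_mul, hf, h1,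
    Complex.one_re, Real.sqrt_one] at h
  have h2 := f.norm_apply_le_of_nonneg (star x * x) (star_mul_self_nonneg x)
  rw [hf, hf, h1, norm_one, one_mul, CStarRing.norm_star_mul_self] at h2
  refine h.trans ?_
  rw [Real.sqrt_le_left (norm_nonneg _)]
  calc _ ≤ _ := Complex.re_le_norm _
    _ ≤ _ := h2
    _ = _ := by ring

/-- A contractive unital functional is positive. -/
lemma positive_of_contractive {C : Type*} [CStarAlgebra C] (φ : C →L[ℂ] ℂ) (h1 : φ 1 = 1)
    (hc : ∀ x, ‖φ x‖ ≤ ‖x‖) (x : C) : ∃ r : ℝ, 0 ≤ r ∧ φ (star x * x) = (r : ℂ) := by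
  let _ : PartialOrder C := CStarAlgebra.spectralOrder C
  have _ : StarOrderedRing C := CStarAlgebra.spectralOrderedRing C
  have hreal : ∀ a : C, IsSelfAdjoint a → (φ a).im = 0 := by
    intro a ha
    by_contra ht
    have key : ∀ r : ℝ, (φ a).re ^ 2 + ((φ a).im + r) ^ 2 ≤ ‖a‖ ^ 2 + r ^ 2 * ‖(1 : C)‖ := by
      intro r
      have e1 := hc (a + ((r : ℂ) * Complex.I) • 1)
      have e2 : ‖φ (a + ((r : ℂ) * Complex.I) • 1)‖ ^ 2
          = (φ a).re ^ 2 + ((φ a).im + r) ^ 2 := by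
        rw [map_add, map_smul, h1, Complex.sq_norm, Complex.normSq_apply]
        simp
        ring
      have e3 : ‖a + ((r : ℂ) * Complex.I) • (1 : C)‖ ^ 2 ≤ ‖a‖ ^ 2 + r ^ 2 * ‖(1 : C)‖ := by
        rw [sq, ← CStarRing.norm_star_mul_self]
        have : star (a + ((r : ℂ) * Complex.I) • (1 : C)) * (a + ((r : ℂ) * Complex.I) • (1 : C))
            = a * a + ((r : ℂ) ^ 2) • (1 : C) := by
          have hI : ((r : ℂ) * Complex.I) * ((r : ℂ) * Complex.I) = - (r : ℂ) ^ 2 := by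
            linear_combination (r : ℂ) ^ 2 * Complex.I_mul_I
          simp only [star_add, star_smul, star_one, ha.star_eq, add_mul, mul_add, smul_mul_assoc,
            one_mul, mul_smul_comm, mul_one, smul_add, smul_smul]
          simp only [Complex.star_def, map_mul, Complex.conj_ofReal, Complex.conj_I, mul_neg,
            neg_mul, hI, neg_neg, neg_smul]
          abel
        rw [this]
        refine (norm_add_le _ _).trans ?_
        have n1 : ‖a * a‖ ≤ ‖a‖ ^ 2 := by rw [sq]; exact norm_mul_le a a
        have n2 : ‖((r : ℂ) ^ 2) • (1 : C)‖ = r ^ 2 * ‖(1 : C)‖ := by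
          rw [norm_smul, norm_pow, Complex.norm_real, Real.norm_eq_abs, sq_abs]
        rw [n2]
        exact add_le_add_left n1 _
      rw [← e2]
      exact le_trans (by gcongr) e3
    have hone : ‖(1 : C)‖ ≤ 1 := by
      rcases subsingleton_or_nontrivial C with h | h
      · simp [Subsingleton.elim (1 : C) 0]
      · exact (CStarRing.norm_one (E := C)).le
    have k := key (‖a‖ ^ 2 / (φ a).im)
    have k2 : (‖a‖ ^ 2 / (φ a).im) ^ 2 * ‖(1 : C)‖ ≤ (‖a‖ ^ 2 / (φ a).im) ^ 2 := by
      nlinarith [sq_nonneg (‖a‖ ^ 2 / (φ a).im)]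
    have k3 : (φ a).im * (‖a‖ ^ 2 / (φ a).im) = ‖a‖ ^ 2 := by field_simp
    have : 0 < (φ a).im ^ 2 := by positivity
    nlinarith [sq_nonneg (φ a).re, sq_nonneg ‖a‖]
  set a := star x * x with ha
  have hsa : IsSelfAdjoint a := IsSelfAdjoint.star_mul_self x
  have ha0 : 0 ≤ a := star_mul_self_nonneg x
  have hle : a ≤ algebraMap ℝ C ‖a‖ := hsa.le_algebraMap_norm_self
  refine ⟨(φ a).re, ?_, Complex.ext rfl (by simp [hreal a hsa])⟩
  have hn : ‖algebraMap ℝ C ‖a‖ - a‖ ≤ ‖a‖ := by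
    rw [CStarAlgebra.norm_le_iff_le_algebraMap _ (norm_nonneg _) (sub_nonneg.mpr hle)]
    exact sub_le_self _ ha0
  have h := (hc _).trans hn
  have e : φ (algebraMap ℝ C ‖a‖) = (‖a‖ : ℂ) := by
    rw [Algebra.algebraMap_eq_smul_one, ← Complex.coe_smul, map_smul, h1]
    simp
  rw [map_sub, e] at h
  have := (Complex.re_le_norm _).trans h
  simp at this
  exact this

/-- The norm of a self-adjoint element is attained at a state. -/
lemma exists_state {C : Type*} [CStarAlgebra C] [Nontrivial C] (h : C) (hh : IsSelfAdjoint h) :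
    ∃ φ : C →L[ℂ] ℂ, (φ 1 = 1 ∧ ∀ x : C, ∃ r : ℝ, 0 ≤ r ∧ φ (star x * x) = (r : ℂ)) ∧
      ‖φ h‖₊ = ‖h‖₊ := by
  have hn : IsStarNormal h := hh.isStarNormal
  obtain ⟨k, hk, hk2⟩ := spectrum.exists_nnnorm_eq_spectralRadius h
  rw [hh.spectralRadius_eq_nnnorm] at hk2
  obtain ⟨χ, hχ⟩ := (StarAlgebra.elemental.bijective_characterSpaceToSpectrum h).2 ⟨k, hk⟩
  have hχ' : χ ⟨h, StarAlgebra.elemental.self_mem ℂ h⟩ = k := congrArg Subtype.val hχ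
  let p : Subspace ℂ C := Subalgebra.toSubmodule (StarAlgebra.elemental ℂ h).toSubalgebra
  let g : StrongDual ℂ p := WeakDual.toStrongDual (χ : WeakDual ℂ (StarAlgebra.elemental ℂ h))
  have hg : ‖g‖ ≤ 1 :=
    (WeakDual.CharacterSpace.norm_le_norm_one χ).trans (CStarRing.norm_one (E := C)).le
  obtain ⟨φ, hφ, hφn⟩ := exists_extension_norm_eq p g
  have h1 : φ 1 = 1 := (hφ ⟨1, one_mem (StarAlgebra.elemental ℂ h)⟩).trans (map_one χ)
  have h2 : φ h = k := (hφ ⟨h, StarAlgebra.elemental.self_mem ℂ h⟩).trans hχ'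
  refine ⟨φ, ⟨h1, positive_of_contractive φ h1 fun x => ?_⟩, ?_⟩
  · refine (φ.le_opNorm x).trans ?_
    rw [hφn]
    nlinarith [norm_nonneg x]
  · rw [h2]; exact_mod_cast hk2

/-- The self-adjoint dilation. -/
def dil {A : Type*} [AddMonoid A] [StarAddMonoid A] {n : ℕ} (M : Matrix (Fin n) (Fin n) A) :
    Matrix (Fin (n + n)) (Fin (n + n)) A :=
  Matrix.reindex finSumFinEquiv finSumFinEquiv (Matrix.fromBlocks 0 M (star M) 0)

lemma star_dil {A : Type*} [AddMonoid A] [StarAddMonoid A] {n : ℕ}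
    (M : Matrix (Fin n) (Fin n) A) : star (dil M) = dil M := by
  rw [dil, Matrix.star_eq_conjTranspose, Matrix.conjTranspose_reindex,
    Matrix.fromBlocks_conjTranspose]
  simp [Matrix.star_eq_conjTranspose]

/-- Block diagonal embedding. -/
def diagHom {A C D : Type*} [CStarAlgebra A] [CStarAlgebra C] [CStarAlgebra D] {n : ℕ}
    (e : Matrix (Fin n) (Fin n) A ≃⋆ₐ[ℂ] C)
    (e' : Matrix (Fin (n + n)) (Fin (n + n)) A ≃⋆ₐ[ℂ] D) : C × C →⋆ₙₐ[ℂ] D where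
  toFun p := e' (Matrix.reindex finSumFinEquiv finSumFinEquiv
    (Matrix.fromBlocks (e.symm p.1) 0 0 (e.symm p.2)))
  map_smul' c p := by
    rw [← map_smul]
    congr 1
    ext i j
    simp only [Matrix.reindex_apply, Matrix.submatrix_apply, Matrix.smul_apply]
    rcases finSumFinEquiv.symm i with i | i <;> rcases finSumFinEquiv.symm j with j | j <;> simp
  map_zero' := by simp
  map_add' p q := by
    rw [← map_add]
    congr 1
    ext i j
    simp only [Matrix.reindex_apply, Matrix.submatrix_apply, Matrix.add_apply]
    rcases finSumFinEquiv.symm i with i | i <;> rcases finSumFinEquiv.symm j with j | j <;> simp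
  map_mul' p q := by
    rw [← map_mul]
    congr 1
    simp [Matrix.fromBlocks_multiply, Matrix.submatrix_mul_equiv]
  map_star' p := by
    rw [← map_star]
    congr 1
    simp [Matrix.star_eq_conjTranspose, Matrix.fromBlocks_conjTranspose, map_star]

lemma norm_dil {A C D : Type*} [CStarAlgebra A] [CStarAlgebra C] [CStarAlgebra D] {n : ℕ}
    (e : Matrix (Fin n) (Fin n) A ≃⋆ₐ[ℂ] C)
    (e' : Matrix (Fin (n + n)) (Fin (n + n)) A ≃⋆ₐ[ℂ] D) (M : Matrix (Fin n) (Fin n) A) :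
    ‖e' (dil M)‖ = ‖e M‖ := by
  have hinj : Function.Injective (diagHom e e') := by
    intro p q h
    have h2 := (Matrix.reindex finSumFinEquiv finSumFinEquiv).injective (e'.injective h)
    rw [Matrix.fromBlocks_inj] at h2
    exact Prod.ext (e.symm.injective h2.1) (e.symm.injective h2.2.2.2)
  have h := NonUnitalStarAlgHom.norm_map (diagHom e e') hinj (e M * star (e M), star (e M) * e M)
  have hd : diagHom e e' (e M * star (e M), star (e M) * e M)
      = star (e' (dil M)) * e' (dil M) := by
    rw [← map_star e', star_dil, ← map_mul]
    change e' _ = _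
    congr 1
    simp [dil, Matrix.fromBlocks_multiply, Matrix.submatrix_mul_equiv, ← map_star, ← map_mul]
  rw [hd, CStarRing.norm_star_mul_self, Prod.norm_def, CStarRing.norm_self_mul_star,
    CStarRing.norm_star_mul_self, max_self] at h
  exact (mul_self_inj (norm_nonneg _) (norm_nonneg _)).mp h

lemma dil_map {A B : Type*} [CStarAlgebra A] [CStarAlgebra B] (Φ : A →L[ℂ] B)
    (hΦ : ∀ a : A, Φ (star a) = star (Φ a)) {n : ℕ} (M : Matrix (Fin n) (Fin n) A) :
    (dil M).map Φ = dil (M.map Φ) := by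
  have : (star M).map Φ = star (M.map Φ) := by
    ext i j
    simp [Matrix.star_apply, hΦ]
  rw [dil, dil, ← this]
  ext i j
  simp only [Matrix.reindex_apply, Matrix.map_apply, Matrix.submatrix_apply]
  rcases finSumFinEquiv.symm i with i | i <;> rcases finSumFinEquiv.symm j with j | j <;> simp

end CbAux

/-- **C*-algebraic form of Proposition 5.2 of the paper.** Let `A`, `B` be unital
C*-algebras and `Φ : A →L[ℂ] B` a continuous linear star-preserving map.  For each `n`, let
`Φₙ` be the entrywise application of `Φ` to n×n matrices (carrying their canonical C*-norms).
Then, as suprema in `[0, ∞]`, the completely bounded norm of `Φ` satisfies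
`⨆ₙ ⨆ {‖Φₙ M‖ : ‖M‖ ≤ 1} = ⨆ₙ ⨆_φ ⨆ {|φ (Φₙ M)| : ‖M‖ ≤ 1}`, where for each `n` the inner
supremum is over all states `φ` on the C*-algebra of n×n matrices over `B`, i.e. all
continuous linear functionals `φ` into `ℂ` with `φ 1 = 1` and `φ (star x * x)` a nonnegative
real for all `x`.

Since `CStarMatrix` is not available in this version of Mathlib, we model "the C*-algebra of
n×n matrices over `A` (resp. `B`) with its canonical C*-norm" as an arbitrary C*-algebra
`MA n` (resp. `MB n`) equipped with a ℂ-star-algebra isomorphism from the *-algebra of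
n×n matrices; this is faithful because a *-algebra carries at most one complete C*-norm.
The entrywise application `Φₙ` is `Matrix.map · Φ`, transported along these isomorphisms. -/
theorem cbNorm_eq_iSup_states
    {A B : Type*} [CStarAlgebra A] [CStarAlgebra B]
    (MA MB : ℕ → Type*) [∀ n, CStarAlgebra (MA n)] [∀ n, CStarAlgebra (MB n)]
    (eA : ∀ n, Matrix (Fin n) (Fin n) A ≃⋆ₐ[ℂ] MA n)
    (eB : ∀ n, Matrix (Fin n) (Fin n) B ≃⋆ₐ[ℂ] MB n)
    (Φ : A →L[ℂ] B) (hΦ : ∀ a : A, Φ (star a) = star (Φ a)) :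
    (⨆ (n : ℕ) (m : MA n) (_ : ‖m‖ ≤ 1),
        (‖eB n (((eA n).symm m).map Φ)‖₊ : ℝ≥0∞))
      = ⨆ (n : ℕ)
          (φ : {φ : MB n →L[ℂ] ℂ //
            φ 1 = 1 ∧ ∀ x : MB n, ∃ r : ℝ, 0 ≤ r ∧ φ (star x * x) = (r : ℂ)})
          (m : MA n) (_ : ‖m‖ ≤ 1),
          (‖(φ : MB n →L[ℂ] ℂ) (eB n (((eA n).symm m).map Φ))‖₊ : ℝ≥0∞) := by
  apply le_antisymm
  · refine iSup_le fun n => iSup_le fun m => iSup_le fun hm => ?_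
    set M := (eA n).symm m with hM
    have hmM : eA n M = m := by simp [hM]
    have hA : ‖eA (n + n) (CbAux.dil M)‖ ≤ 1 := by
      rw [CbAux.norm_dil (eA n), hmM]; exact hm
    have hB := CbAux.norm_dil (eB n) (eB (n + n)) (M.map Φ)
    have hsa : IsSelfAdjoint (eB (n + n) (CbAux.dil (M.map Φ))) := by
      rw [IsSelfAdjoint, ← map_star, CbAux.star_dil]
    rcases subsingleton_or_nontrivial (MB (n + n)) with hs | hs
    · have h0 : ‖eB n (M.map Φ)‖ = 0 := by
        rw [← hB, Subsingleton.elim (eB (n + n) (CbAux.dil (M.map Φ))) 0, norm_zero]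
      have h1 : ‖eB n (M.map Φ)‖₊ = 0 := NNReal.eq h0
      rw [h1]
      simp
    · obtain ⟨φ, hφ, hφn⟩ := CbAux.exists_state _ hsa
      refine le_iSup_of_le (n + n) <| le_iSup_of_le ⟨φ, hφ⟩ <|
        le_iSup_of_le (eA (n + n) (CbAux.dil M)) <| le_iSup_of_le hA ?_
      have e : (eA (n + n)).symm (eA (n + n) (CbAux.dil M)) = CbAux.dil M := by simp
      rw [e, CbAux.dil_map Φ hΦ]
      simp only [hφn]
      rw [show ‖eB (n + n) (CbAux.dil (M.map Φ))‖₊ = ‖eB n (M.map Φ)‖₊ from NNReal.eq hB]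
  · refine iSup_le fun n => iSup_le fun φ => iSup_le fun m => iSup_le fun hm => ?_
    refine le_iSup_of_le n <| le_iSup_of_le m <| le_iSup_of_le hm ?_
    exact_mod_cast CbAux.state_contractive φ.1 φ.2.1 φ.2.2 _
end
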